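/- arXiv:math/0309192 — 2 statements merged into one kernel-verified Lean document; each statement's English description precedes it below -/
import Mathlib

section
/- Let X = (Γ,|B|,K) be a labeled graph. Suppose there exists ε > 0 such that for every charge collection K' : V → ℝ with |k'_v − k_v| < ε for all v ∈ V, the BKN-equation over the labeled graph X' = (Γ,|B|,K') (same graph and weights, charges K') has an NPC-solution. Then X is an ideal. -/
open Finset Matrix

/-- A labeled graph `X = (Γ, |B|, K)`: a finite connected graph with oriented edge set `W`
(carrying the fixed-point-free orientation-reversal involution `rev` and initial-vertex map
`ini`), positive integer weights `b` on oriented edges with `b (rev w) = b w`, and real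
charges `k` on vertices. -/
structure LabeledGraph (V W : Type) [Fintype V] [DecidableEq V] [Fintype W] [DecidableEq W] where
  rev : W → W
  rev_invol : ∀ w, rev (rev w) = w
  rev_ne : ∀ w, rev w ≠ w
  ini : W → V
  b : W → ℕ
  b_pos : ∀ w, 0 < b w
  b_symm : ∀ w, b (rev w) = b w
  k : V → ℝ
  edges_nonempty : Nonempty W
  connected : ∀ u v : V,
    Relation.ReflTransGen (fun x y => ∃ w, ini w = x ∧ ini (rev w) = y) u v

namespace LabeledGraph

variable {V W : Type} [Fintype V] [DecidableEq V] [Fintype W] [DecidableEq W]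

/-- The terminal vertex `w⁺ = (-w)⁻` of an oriented edge. -/
def ter (X : LabeledGraph V W) (w : W) : V := X.ini (X.rev w)

/-- The BKN-equation over `X`: `k_v · a_v = Σ_{w ∈ ∂v} (γ_w/|b_w|) · a_{w⁺}` for all `v`. -/
def BKN (X : LabeledGraph V W) (a : V → ℝ) (γ : W → ℝ) : Prop :=
  ∀ v : V, X.k v * a v =
    ∑ w ∈ univ.filter (fun w => X.ini w = v), γ w / (X.b w : ℝ) * a (X.ter w)

/-- Compatibility of a solution `(a,γ)`. -/
def Compatible (X : LabeledGraph V W) (a : V → ℝ) (γ : W → ℝ) : Prop :=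
  (∀ v, 0 ≤ a v) ∧ a ≠ 0 ∧ (∀ w, |γ w| ≤ 1) ∧
    (∀ w, |γ w * γ (X.rev w)| = 1 → γ (X.rev w) = γ w) ∧
    (∀ v, a v = 0 → ∀ w, X.ini w = v → γ w = 0 ∧ γ (X.rev w) = 0)

/-- The angle function is symmetric: `γ_{-w} = γ_w`. -/
def SymSol (X : LabeledGraph V W) (γ : W → ℝ) : Prop := ∀ w, γ (X.rev w) = γ w

/-- An NPC-solution: a compatible symmetric solution with positive length function and
`|γ| < 1`. -/
def NPCSolution (X : LabeledGraph V W) (a : V → ℝ) (γ : W → ℝ) : Prop :=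
  X.BKN a γ ∧ X.Compatible a γ ∧ X.SymSol γ ∧ (∀ v, 0 < a v) ∧ ∀ w, |γ w| < 1

/-- The operator `A⁺ = D⁺ − J` on `ℝ^V`. -/
noncomputable def Aplus (X : LabeledGraph V W) : Matrix V V ℝ :=
  Matrix.of fun v v' =>
    (if v = v' then |X.k v| else 0)
      - ∑ w ∈ univ.filter (fun w => X.ini w = v ∧ X.ter w = v'), (1 : ℝ) / (X.b w)

/-- The operator `A_λ = D − J_λ` on `ℝ^V` for a (symmetric `±1`-valued) function `λ` on `W`. -/
noncomputable def Aop (X : LabeledGraph V W) (lam : W → ℝ) : Matrix V V ℝ :=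
  Matrix.of fun v v' =>
    (if v = v' then X.k v else 0)
      - ∑ w ∈ univ.filter (fun w => X.ini w = v ∧ X.ter w = v'), lam w / (X.b w : ℝ)

/-- Two vertices lie in the same sign component. -/
def SameSign (X : LabeledGraph V W) : V → V → Prop :=
  Relation.ReflTransGen fun x y =>
    (∃ w, X.ini w = x ∧ X.ter w = y) ∧ 0 < X.k x * X.k y

/-- A `±1`-valued sign function `s` of type (ii): constant on sign components, alternating
along edges joining distinct sign components, and equal to `1` at some vertex of positive
charge. -/
def TypeII (X : LabeledGraph V W) (s : V → ℝ) : Prop :=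
  (∀ v, s v = 1 ∨ s v = -1) ∧
    (∀ u v, X.SameSign u v → s u = s v) ∧
    (∀ w, ¬ X.SameSign (X.ini w) (X.ter w) → s (X.ini w) = - s (X.ter w)) ∧
    (∃ v, s v = 1 ∧ 0 < X.k v)

/-- An admissible sign function: of type (ii), or identically zero when no type (ii)
function exists. -/
def Admissible (X : LabeledGraph V W) (s : V → ℝ) : Prop :=
  X.TypeII s ∨ (s = 0 ∧ ¬ ∃ s', X.TypeII s')

open scoped Classical in
/-- The operator `H = D_s − J₀` associated with an admissible sign function `s`; only
oriented edges with both endpoints in one and the same sign component contribute. -/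
noncomputable def Hop (X : LabeledGraph V W) (s : V → ℝ) : Matrix V V ℝ :=
  Matrix.of fun v v' =>
    (if v = v' then s v * X.k v else 0)
      - ∑ w ∈ univ.filter
          (fun w => X.ini w = v ∧ X.ter w = v' ∧ X.SameSign (X.ini w) (X.ter w)),
          (1 : ℝ) / (X.b w)

/-- `A` has a nonpositive real eigenvalue. -/
def HasNonposEigenvalue (A : Matrix V V ℝ) : Prop :=
  ∃ μ : ℝ, μ ≤ 0 ∧ ∃ x : V → ℝ, x ≠ 0 ∧ A.mulVec x = μ • x

/-- `A` has a negative real eigenvalue. -/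
def HasNegEigenvalue (A : Matrix V V ℝ) : Prop :=
  ∃ μ : ℝ, μ < 0 ∧ ∃ x : V → ℝ, x ≠ 0 ∧ A.mulVec x = μ • x

/-- `A` is positive semidefinite: `(Ax,x) ≥ 0` for all `x`. -/
def PosSemidef' (A : Matrix V V ℝ) : Prop := ∀ x : V → ℝ, 0 ≤ x ⬝ᵥ A.mulVec x

/-- `A` is singular: it has a nontrivial kernel. -/
def Singular (A : Matrix V V ℝ) : Prop := ∃ x : V → ℝ, x ≠ 0 ∧ A.mulVec x = 0

/-- `A` is supersingular: its kernel contains a vector with all coordinates nonzero. -/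
def Supersingular (A : Matrix V V ℝ) : Prop :=
  ∃ x : V → ℝ, (∀ v, x v ≠ 0) ∧ A.mulVec x = 0

/-- `A` is weakly singular: there is a nonzero `x` with `(Ax)_v = 0` at every vertex of the
support of `x`. -/
def WeaklySingular (A : Matrix V V ℝ) : Prop :=
  ∃ x : V → ℝ, x ≠ 0 ∧ ∀ v, x v ≠ 0 → A.mulVec x v = 0


/-- An embedding of `X` into `X'` as a labeled subgraph: injections of vertices and
oriented edges commuting with the initial-vertex maps and orientation-reversal involutions,
preserving charges and weights. -/
structure SubgraphEmb {V W V' W' : Type}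
    [Fintype V] [DecidableEq V] [Fintype W] [DecidableEq W]
    [Fintype V'] [DecidableEq V'] [Fintype W'] [DecidableEq W']
    (X : LabeledGraph V W) (X' : LabeledGraph V' W') where
  vmap : V → V'
  wmap : W → W'
  vmap_inj : Function.Injective vmap
  wmap_inj : Function.Injective wmap
  ini_comm : ∀ w, X'.ini (wmap w) = vmap (X.ini w)
  rev_comm : ∀ w, X'.rev (wmap w) = wmap (X.rev w)
  k_comm : ∀ v, X'.k (vmap v) = X.k v
  b_comm : ∀ w, X'.b (wmap w) = X.b w

/-- `X` is an ideal: for every labeled graph `X'` containing `X` as a labeled subgraph,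
the BKN-equation over `X'` has an NPC-solution. -/
def IsIdeal {V W : Type} [Fintype V] [DecidableEq V] [Fintype W] [DecidableEq W]
    (X : LabeledGraph V W) : Prop :=
  ∀ (V' W' : Type) [Fintype V'] [DecidableEq V'] [Fintype W'] [DecidableEq W']
    (X' : LabeledGraph V' W'),
    Nonempty (X.SubgraphEmb X') → ∃ (a : V' → ℝ) (γ : W' → ℝ), X'.NPCSolution a γ

/-- The labeled graph obtained from `X` by replacing its charges by `K'` (same graph and
same weights). -/
def withCharges {V W : Type} [Fintype V] [DecidableEq V] [Fintype W] [DecidableEq W]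
    (X : LabeledGraph V W) (K' : V → ℝ) : LabeledGraph V W :=
  { X with k := K' }

end LabeledGraph

namespace LabeledGraph

variable {V W : Type} [Fintype V] [DecidableEq V] [Fintype W] [DecidableEq W]

/-- The BKN-equation restricted to the vertices of `S` is stably solvable: for all charges close
to those of `X` on `S`, it has a symmetric solution with positive lengths and angles of modulus
less than `1` which vanish outside the edges spanned by `S`. -/
def StablySolvableOn (X : LabeledGraph V W) (S : Finset V) : Prop :=
  ∃ ε > (0 : ℝ), ∀ K : V → ℝ, (∀ v ∈ S, |K v - X.k v| < ε) →
    ∃ (a : V → ℝ) (γ : W → ℝ), (∀ v, 0 < a v) ∧ (∀ w, |γ w| < 1) ∧ X.SymSol γ ∧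
      (∀ w, X.ini w ∉ S → γ w = 0) ∧
      ∀ v ∈ S, K v * a v =
        ∑ w ∈ univ.filter (fun w => X.ini w = v), γ w / (X.b w : ℝ) * a (X.ter w)

/-- A nonempty proper set of vertices is left by some edge. -/
theorem exists_edge_into (X : LabeledGraph V W) {S : Finset V} (hS : S.Nonempty)
    (hne : S ≠ univ) : ∃ w, X.ini w ∉ S ∧ X.ter w ∈ S := by
  by_contra! hcon
  obtain ⟨s, hs⟩ := hS
  refine hne (eq_univ_iff_forall.2 fun v => ?_)
  induction X.connected s v with
  | refl => exact hs
  | tail _ hyz ih =>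
    obtain ⟨w, rfl, rfl⟩ := hyz
    by_contra hz
    exact hcon (X.rev w) hz (by simpa [ter, X.rev_invol] using ih)

/-- Stable solvability extends along an edge to a new vertex: give the new vertex a length that
is a small multiple of the length of its neighbour. -/
theorem StablySolvableOn.insert {X : LabeledGraph V W} {S : Finset V}
    (hS : X.StablySolvableOn S) {e : W} (hu : X.ini e ∉ S) (hr : X.ter e ∈ S) :
    X.StablySolvableOn (insert (X.ini e) S) := by
  obtain ⟨ε, hε, H⟩ := hS
  have hb : (0 : ℝ) < X.b e := by exact_mod_cast X.b_pos e
  obtain ⟨M, hM0, hM⟩ : ∃ M : ℝ, 0 < M ∧ |X.k (X.ini e)| + 1 ≤ M :=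
    ⟨|X.k (X.ini e)| + 1, by positivity, le_rfl⟩
  obtain ⟨δ, hδ, hδ1, hδb, hδε⟩ : ∃ δ : ℝ, 0 < δ ∧ δ < 1 ∧ M * δ * X.b e < 1 ∧
      M * δ < ε / 2 := by
    have h1 : ∀ᶠ δ in nhdsWithin (0 : ℝ) (Set.Ioi 0), δ < 1 ∧ M * δ * X.b e < 1 ∧
        M * δ < ε / 2 := by
      apply Filter.Eventually.filter_mono nhdsWithin_le_nhds
      refine Filter.Eventually.and ?_ (Filter.Eventually.and ?_ ?_)
      · exact ContinuousAt.eventually_lt (f := fun δ : ℝ => δ) (by fun_prop)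
          continuousAt_const (by norm_num)
      · exact ContinuousAt.eventually_lt (f := fun δ : ℝ => M * δ * X.b e) (by fun_prop)
          continuousAt_const (by norm_num)
      · exact ContinuousAt.eventually_lt (f := fun δ : ℝ => M * δ) (by fun_prop)
          continuousAt_const (by simpa using hε)
    obtain ⟨δ, h2, h3⟩ := (h1.and self_mem_nhdsWithin).exists
    exact ⟨δ, h3, h2⟩
  refine ⟨min 1 (ε / 2), by positivity, fun K hK => ?_⟩
  have hKu : |K (X.ini e)| < M := by
    have h1 := (hK _ (mem_insert_self _ _)).trans_le (min_le_left _ _)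
    have h2 := abs_sub_abs_le_abs_sub (K (X.ini e)) (X.k (X.ini e))
    linarith
  have hKδ : |K (X.ini e) * δ ^ 2| < ε / 2 := by
    rw [abs_mul, abs_of_pos (pow_pos hδ 2)]
    have h1 : |K (X.ini e)| * δ ≤ M * δ := by gcongr
    have h2 : M * δ * δ ≤ M * δ := mul_le_of_le_one_right (by positivity) hδ1.le
    nlinarith
  obtain ⟨a, γ, ha, hγ, hsym, hoff, heq⟩ :=
    H (fun v => K v - if v = X.ter e then K (X.ini e) * δ ^ 2 else 0) (by
      intro v hv
      have h1 := (hK v (mem_insert_of_mem hv)).trans_le (min_le_right _ _)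
      rw [abs_lt] at h1 hKδ ⊢
      split_ifs <;> constructor <;> linarith)
  have hγe : γ e = 0 := hoff e hu
  have hγe' : γ (X.rev e) = 0 := by rw [hsym, hγe]
  have hne : X.rev e ≠ e := X.rev_ne e
  have hru : X.ter e ≠ X.ini e := fun h => hu (h ▸ hr)
  have hterrev : X.ter (X.rev e) = X.ini e := by simp [ter, X.rev_invol]
  have hinirev : X.ini (X.rev e) = X.ter e := rfl
  have hterm : ∀ w, (if w = e ∨ w = X.rev e then K (X.ini e) * δ * X.b e else γ w) / (X.b w : ℝ)
      * Function.update a (X.ini e) (δ * a (X.ter e)) (X.ter w)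
      = γ w / (X.b w : ℝ) * a (X.ter w)
        + ((if w = e then K (X.ini e) * δ * a (X.ter e) else 0)
        + (if w = X.rev e then K (X.ini e) * δ ^ 2 * a (X.ter e) else 0)) := by
    intro w
    by_cases h1 : w = e
    · subst h1
      simp only [true_or, if_true, hne.symm, if_false, hγe, Function.update_of_ne hru]
      field_simp
      ring
    by_cases h2 : w = X.rev e
    · subst h2
      simp only [or_true, if_true, hne, if_false, hγe', hterrev, Function.update_self, X.b_symm]
      field_simp
      ring
    simp only [h1, h2, or_self, if_false, add_zero]
    by_cases h3 : X.ter w = X.ini e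
    · have : γ w = 0 := by
        rw [← hsym w]
        exact hoff _ (by rw [← h3] at hu; exact hu)
      simp [this]
    · rw [Function.update_of_ne h3]
  refine ⟨Function.update a (X.ini e) (δ * a (X.ter e)),
    fun w => if w = e ∨ w = X.rev e then K (X.ini e) * δ * X.b e else γ w, ?_, ?_, ?_, ?_, ?_⟩
  · intro v
    by_cases hv : v = X.ini e
    · subst hv
      rw [Function.update_self]
      exact mul_pos hδ (ha _)
    · rw [Function.update_of_ne hv]
      exact ha v
  · intro w
    dsimp only
    split_ifs
    · rw [abs_mul, abs_mul, abs_of_pos hδ, abs_of_pos hb]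
      refine lt_of_le_of_lt ?_ hδb
      gcongr
    · exact hγ w
  · intro w
    have h1 : X.rev w = e ↔ w = X.rev e :=
      ⟨fun h => by rw [← h, X.rev_invol], fun h => by rw [h, X.rev_invol]⟩
    have h2 : X.rev w = X.rev e ↔ w = e :=
      ⟨fun h => by rw [← X.rev_invol w, h, X.rev_invol], fun h => by rw [h]⟩
    simp only [h1, h2, hsym w, or_comm]
  · intro w hw
    rw [mem_insert, not_or] at hw
    have h1 : w ≠ e := fun h => hw.1 (h ▸ rfl)
    have h2 : w ≠ X.rev e := fun h => hw.2 (by rw [h, hinirev]; exact hr)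
    simp only [h1, h2, or_self, if_false]
    exact hoff w hw.2
  · intro v hv
    rw [sum_congr rfl fun w _ => hterm w, sum_add_distrib, sum_add_distrib, sum_ite_eq',
      sum_ite_eq']
    simp only [mem_filter, mem_univ, true_and, hinirev]
    by_cases hvu : v = X.ini e
    · subst hvu
      rw [sum_eq_zero, Function.update_self, if_pos rfl, if_neg hru]
      · ring
      · intro w hw
        rw [hoff w (by rw [(mem_filter.1 hw).2]; exact hu)]
        simp
    · have hvS : v ∈ S := (mem_insert.1 hv).resolve_left hvu
      rw [← heq v hvS, Function.update_of_ne hvu, if_neg (Ne.symm hvu)]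
      by_cases hvr : v = X.ter e
      · subst hvr
        simp only [if_true]
        ring
      · simp [hvr, Ne.symm hvr]

/-- Stable solvability on a nonempty vertex set extends to the whole graph. -/
theorem StablySolvableOn.extend_univ {X : LabeledGraph V W} {S : Finset V} (hne : S.Nonempty)
    (hS : X.StablySolvableOn S) : X.StablySolvableOn univ := by
  induction hn : Sᶜ.card using Nat.strong_induction_on generalizing S with
  | _ n ih =>
    by_cases h : S = Finset.univ
    · exact h ▸ hS
    · obtain ⟨e, hu, hr⟩ := X.exists_edge_into hne h
      refine ih _ ?_ (insert_nonempty _ _) (hS.insert hu hr) rfl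
      rw [← hn]
      exact card_lt_card (Finset.compl_ssubset_compl.2 (ssubset_insert hu))

theorem StablySolvableOn.exists_npcSolution {X : LabeledGraph V W}
    (hX : X.StablySolvableOn univ) : ∃ (a : V → ℝ) (γ : W → ℝ), X.NPCSolution a γ := by
  obtain ⟨ε, hε, H⟩ := hX
  obtain ⟨a, γ, ha, hγ, hsym, -, heq⟩ := H X.k (by simp [hε])
  obtain ⟨w⟩ := X.edges_nonempty
  exact ⟨a, γ, fun v => heq v (mem_univ v),
    ⟨fun v => (ha v).le, fun h => (ha (X.ini w)).ne' (congrFun h _), fun w => (hγ w).le,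
      fun w _ => hsym w, fun v hv => absurd hv (ha v).ne'⟩, hsym, ha, hγ⟩

/-- Stable solvability over a labeled subgraph gives stable solvability on its vertices. -/
theorem SubgraphEmb.stablySolvableOn {V' W' : Type}
    [Fintype V'] [DecidableEq V'] [Fintype W'] [DecidableEq W']
    {X : LabeledGraph V W} {X' : LabeledGraph V' W'} (i : X.SubgraphEmb X')
    (h : ∃ ε > (0 : ℝ), ∀ K' : V → ℝ, (∀ v, |K' v - X.k v| < ε) →
      ∃ (a : V → ℝ) (γ : W → ℝ), (X.withCharges K').NPCSolution a γ) :
    X'.StablySolvableOn (univ.image i.vmap) := by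
  obtain ⟨ε, hε, H⟩ := h
  refine ⟨ε, hε, fun K hK => ?_⟩
  obtain ⟨a, γ, heq, -, hsym, ha, hγ⟩ := H (fun v => K (i.vmap v)) fun v => by
    rw [← i.k_comm]
    exact hK _ (mem_image_of_mem _ (mem_univ v))
  have hextγ : ∀ w, Function.extend i.wmap γ 0 (i.wmap w) = γ w :=
    fun w => i.wmap_inj.extend_apply ..
  have hexta : ∀ v, Function.extend i.vmap a 1 (i.vmap v) = a v :=
    fun v => i.vmap_inj.extend_apply ..
  have hzero : ∀ w, (¬ ∃ w₀, i.wmap w₀ = w) → Function.extend i.wmap γ 0 w = 0 :=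
    fun w hw => Function.extend_apply' _ _ _ hw
  refine ⟨Function.extend i.vmap a 1, Function.extend i.wmap γ 0, ?_, ?_, ?_, ?_, ?_⟩
  · intro v
    by_cases hv : ∃ v₀, i.vmap v₀ = v
    · obtain ⟨v₀, rfl⟩ := hv
      rw [hexta]
      exact ha v₀
    · rw [Function.extend_apply' _ _ _ hv]
      exact one_pos
  · intro w
    by_cases hw : ∃ w₀, i.wmap w₀ = w
    · obtain ⟨w₀, rfl⟩ := hw
      rw [hextγ]
      exact hγ w₀
    · simp [hzero w hw]
  · intro w
    by_cases hw : ∃ w₀, i.wmap w₀ = w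
    · obtain ⟨w₀, rfl⟩ := hw
      rw [i.rev_comm, hextγ, hextγ]
      exact hsym w₀
    · rw [hzero w hw, hzero]
      rintro ⟨w₀, hw₀⟩
      exact hw ⟨X.rev w₀, by rw [← i.rev_comm, hw₀, X'.rev_invol]⟩
  · intro w hw
    refine hzero w ?_
    rintro ⟨w₀, rfl⟩
    exact hw (by rw [i.ini_comm]; exact mem_image_of_mem _ (mem_univ _))
  · intro v hv
    obtain ⟨v₀, -, rfl⟩ := mem_image.1 hv
    rw [hexta]
    refine (heq v₀).trans ?_
    refine sum_of_injOn i.wmap i.wmap_inj.injOn ?_ ?_ ?_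
    · intro w hw
      simp only [coe_filter, mem_univ, true_and, Set.mem_ofPred_eq] at hw ⊢
      rw [i.ini_comm]
      exact congrArg _ hw
    · intro w hw hw'
      rw [hzero, zero_div, zero_mul]
      rintro ⟨w₀, rfl⟩
      refine hw' ⟨w₀, ?_, rfl⟩
      simp only [mem_filter, mem_univ, true_and, i.ini_comm] at hw
      exact mem_coe.2 (mem_filter.2 ⟨mem_univ _, i.vmap_inj hw⟩)
    · intro w _
      have hter : X'.ter (i.wmap w) = i.vmap (X.ter w) := by
        simp only [ter, i.rev_comm, i.ini_comm]
      rw [hextγ, hter, hexta, i.b_comm]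
      rfl

end LabeledGraph

open LabeledGraph in
/-- If for every charge collection `K'` in some neighborhood of the charges of `X` the
BKN-equation over the labeled graph with charges `K'` has an NPC-solution, then `X` is an
ideal. -/
theorem isIdeal_of_npc_solution_on_charge_nbhd
    {V W : Type} [Fintype V] [DecidableEq V] [Fintype W] [DecidableEq W]
    (X : LabeledGraph V W)
    (h : ∃ ε > (0 : ℝ), ∀ K' : V → ℝ, (∀ v, |K' v - X.k v| < ε) →
      ∃ (a : V → ℝ) (γ : W → ℝ), (X.withCharges K').NPCSolution a γ) :
    X.IsIdeal := by
  intro V' W' _ _ _ _ X' ⟨i⟩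
  obtain ⟨w⟩ := X.edges_nonempty
  exact ((i.stablySolvableOn h).extend_univ
    ⟨_, mem_image_of_mem _ (mem_univ (X.ini w))⟩).exists_npcSolution
end

section
/- Let X be a labeled graph all of whose charges are rational, and let (a,γ) be a compatible solution of the BKN-equation over X. Then: (1) if γ takes values only in {0,1,−1}, then for every ε > 0 there exists a compatible solution (a',γ) of the BKN-equation over X (with the same angle function γ) such that a' takes only rational values, |a'_v − a_v| < ε for all v ∈ V, and a'_v = a_v for every vertex v with a_v = 0; (2) if |γ_{w₀}| < 1 for some edge w₀ ∈ W, then for every ε > 0 there exists a compatible solution (a',γ') of the BKN-equation over X taking only rational values such that a'_v > 0 for all v ∈ V, |γ'_w| < 1 for all w ∈ W, |a'_v − a_v| < ε for all v ∈ V and |γ'_w − γ_w| < ε for all w ∈ W. -/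
open Finset Matrix

open Filter Topology

/-- Rational points are dense in a power of the reals. -/
theorem exists_rat_fun_mem_of_mem_nhds {ι : Type*} {x : ι → ℝ} {U : Set (ι → ℝ)}
    (hU : U ∈ 𝓝 x) : ∃ q : ι → ℚ, (fun i => (q i : ℝ)) ∈ U := by
  have hd : DenseRange (Pi.map fun (_ : ι) (q : ℚ) => (q : ℝ)) :=
    DenseRange.piMap fun _ => Rat.denseRange_cast
  obtain ⟨_, ⟨q, rfl⟩, hq⟩ := hd.inter_nhds_nonempty hU
  exact ⟨q, hq⟩

/-- Finitely many reals can be approximated simultaneously by their images under a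
`ℚ`-linear functional. -/
theorem exists_rat_linear_mem_of_mem_nhds {ι : Type*} [Finite ι] {a : ι → ℝ}
    {U : Set (ι → ℝ)} (hU : U ∈ 𝓝 a) :
    ∃ f : ℝ →ₗ[ℚ] ℚ, (fun i => (f (a i) : ℝ)) ∈ U := by
  let S : Submodule ℚ ℝ := Submodule.span ℚ (Set.range a)
  have : FiniteDimensional ℚ S := FiniteDimensional.span_of_finite ℚ (Set.finite_range a)
  let B := Module.finBasis ℚ S
  let s : ι → S := fun i => ⟨a i, Submodule.subset_span ⟨i, rfl⟩⟩
  let F : (Fin (Module.finrank ℚ S) → ℝ) → ι → ℝ :=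
    fun e i => ∑ j, (B.repr (s i) j : ℝ) * e j
  have hF : Continuous F := by fun_prop
  have hFB : F (fun j => (B j : ℝ)) = a := by
    funext i
    have h := congrArg S.subtype (B.sum_repr (s i))
    simpa only [map_sum, map_smul, Rat.smul_def, Submodule.subtype_apply] using h
  have hU' : F ⁻¹' U ∈ 𝓝 (fun j => (B j : ℝ)) :=
    hF.continuousAt.preimage_mem_nhds (by rwa [hFB])
  obtain ⟨q, hq⟩ := exists_rat_fun_mem_of_mem_nhds hU'
  obtain ⟨f, hf⟩ := (B.constr ℚ q).exists_extend
  refine ⟨f, ?_⟩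
  convert Set.mem_preimage.1 hq using 1
  funext i
  have h : f (a i) = B.constr ℚ q (s i) := by rw [← hf]; rfl
  simp [F, h, Module.Basis.constr_apply_fintype]

namespace LabeledGraph

variable {V W : Type} [Fintype V] [DecidableEq V] [Fintype W] [DecidableEq W]

theorem ter_rev (X : LabeledGraph V W) (w : W) : X.ter (X.rev w) = X.ini w := by
  rw [ter, X.rev_invol]

/-- A nonempty proper set of vertices has an edge leaving it. -/
theorem exists_edge_leaving (X : LabeledGraph V W) {p : V → Prop} {u v : V} (hu : p u)
    (hv : ¬ p v) : ∃ w, p (X.ini w) ∧ ¬ p (X.ter w) := by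
  by_contra! h
  refine hv ?_
  induction X.connected u v with
  | refl => exact hu
  | tail _ hyz ih =>
    obtain ⟨w, rfl, rfl⟩ := hyz
    by_cases hp : p (X.ini w)
    · exact h w hp
    · exact absurd ih (by tauto)

/-- Every vertex is the initial vertex of some edge. -/
theorem exists_ini_eq (X : LabeledGraph V W) (v : V) : ∃ w, X.ini w = v := by
  obtain ⟨w₀⟩ := X.edges_nonempty
  by_cases h : X.ini w₀ = v
  · exact ⟨w₀, h⟩
  · obtain ⟨w, hw, -⟩ := X.exists_edge_leaving (p := fun x => x = v) rfl h
    exact ⟨w, hw⟩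

/-- Solutions of the BKN-equation with nonnegative lengths, angles bounded by one, and
vanishing angles on the edges ending at vertices of length zero. -/
structure WeakSol (X : LabeledGraph V W) (a : V → ℝ) (γ : W → ℝ) : Prop where
  bkn : X.BKN a γ
  nonneg : ∀ v, 0 ≤ a v
  le_one : ∀ w, |γ w| ≤ 1
  zero : ∀ w, a (X.ter w) = 0 → γ w = 0

/-- Some edge issuing from `v` has angle of absolute value below one and ends at a vertex
of positive length. -/
def Slack (X : LabeledGraph V W) (a : V → ℝ) (γ : W → ℝ) (v : V) : Prop :=
  ∃ w, X.ini w = v ∧ |γ w| < 1 ∧ 0 < a (X.ter w)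

/-- The vertex `v` has positive length and all edges ending at `v` have angle of absolute
value below one. -/
def Regular (X : LabeledGraph V W) (a : V → ℝ) (γ : W → ℝ) (v : V) : Prop :=
  0 < a v ∧ ∀ w, X.ter w = v → |γ w| < 1

/-- A slack vertex becomes regular after an arbitrarily small perturbation: increase its
length, rescale the angles of the edges ending there, and restore the equation at the
vertex by means of the slack edge. -/
theorem WeakSol.exists_regular_at {X : LabeledGraph V W} {a : V → ℝ} {γ : W → ℝ}
    (h : X.WeakSol a γ) {v : V} (hv : X.Slack a γ v) {ε : ℝ} (hε : 0 < ε) :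
    ∃ (a' : V → ℝ) (γ' : W → ℝ), X.WeakSol a' γ' ∧ X.Regular a' γ' v ∧
      (∀ u, 0 < a u → 0 < a' u) ∧ (∀ w, |γ w| < 1 → |γ' w| < 1) ∧
      (∀ u, |a' u - a u| < ε) ∧ ∀ w, |γ' w - γ w| < ε := by
  obtain ⟨e, rfl, he, hae⟩ := hv
  let A : ℝ → V → ℝ := fun η u => if u = X.ini e then a u + η else a u
  let N : ℝ → W → ℝ := fun η w =>
    γ w * a (X.ter w) + if w = e then X.b e * X.k (X.ini e) * η else 0
  let G : ℝ → W → ℝ := fun η w => N η w / A η (X.ter w)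
  have hA0 : ∀ u, A 0 u = a u := by intro u; simp [A]
  have hG0 : ∀ w, G 0 w = γ w := by
    intro w
    by_cases hw : a (X.ter w) = 0
    · simp [G, N, hA0, hw, h.zero w hw]
    · simp [G, N, hA0, hw]
  have hAc : ∀ u, Tendsto (fun η => A η u) (𝓝 0) (𝓝 (a u)) := by
    intro u
    have : Continuous fun η => A η u := by
      by_cases hu : u = X.ini e <;> simp only [A, hu, if_true, if_false] <;> fun_prop
    simpa only [hA0] using this.tendsto 0
  have hNc : ∀ w, Continuous fun η => N η w := by
    intro w
    by_cases hw : w = e <;> simp only [N, hw, if_true, if_false] <;> fun_prop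
  have hGc : ∀ w, Tendsto (fun η => G η w) (𝓝 0) (𝓝 (γ w)) := by
    intro w
    by_cases hw : a (X.ter w) = 0
    · have hwe : w ≠ e := by rintro rfl; exact hae.ne' hw
      have : ∀ η, G η w = γ w := by intro η; simp [G, N, hwe, h.zero w hw]
      simp [this]
    · have := ((hNc w).tendsto 0).div (hAc (X.ter w)) hw
      have h0 : N 0 w / a (X.ter w) = γ w := by rw [← hG0 w]; simp [G, hA0]
      rwa [h0] at this
  have hev : ∀ᶠ η in 𝓝[>] (0 : ℝ), 0 < η ∧ (∀ w, |γ w| < 1 → |G η w| < 1) ∧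
      (∀ u, |A η u - a u| < ε) ∧ ∀ w, |G η w - γ w| < ε := by
    refine (eventually_mem_nhdsWithin (s := Set.Ioi (0 : ℝ))).and
      (eventually_nhdsWithin_of_eventually_nhds ?_)
    refine (eventually_all.2 fun w => ?_).and
      ((eventually_all.2 fun u => ?_).and (eventually_all.2 fun w => ?_))
    · by_cases hw : |γ w| < 1
      · filter_upwards [(hGc w).abs.eventually_lt_const hw] with η hη _ using hη
      · simp [hw]
    · exact Metric.tendsto_nhds.1 (hAc u) ε hε
    · exact Metric.tendsto_nhds.1 (hGc w) ε hε
  obtain ⟨η, hη, hlt, hAε, hGε⟩ := hev.exists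
  have haA : ∀ u, a u ≤ A η u := by
    intro u; simp only [A]; split_ifs <;> linarith
  have hAv : a (X.ini e) < A η (X.ini e) := by simp [A, hη]
  have hGne : ∀ w, w ≠ e → G η w = γ w * (a (X.ter w) / A η (X.ter w)) := by
    intro w hw; simp [G, N, hw, mul_div_assoc]
  have hratio : ∀ u, a u / A η u ≤ 1 := fun u =>
    div_le_one_of_le₀ (haA u) ((h.nonneg u).trans (haA u))
  have hratio0 : ∀ u, 0 ≤ a u / A η u := fun u =>
    div_nonneg (h.nonneg u) ((h.nonneg u).trans (haA u))
  have hmul : ∀ w, G η w * A η (X.ter w) = N η w := by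
    intro w
    by_cases hw : A η (X.ter w) = 0
    · have ha0 : a (X.ter w) = 0 :=
        le_antisymm (hw ▸ haA (X.ter w)) (h.nonneg _)
      have hwe : w ≠ e := by rintro rfl; exact hae.ne' ha0
      simp [hw, N, ha0, hwe]
    · exact div_mul_cancel₀ _ hw
  refine ⟨A η, G η, ⟨?_, fun u => (h.nonneg u).trans (haA u), ?_, ?_⟩, ⟨?_, ?_⟩,
    fun u hu => hu.trans_le (haA u), hlt, hAε, hGε⟩
  · intro u
    have hsum : ∀ w, G η w / (X.b w : ℝ) * A η (X.ter w) =
        γ w / (X.b w : ℝ) * a (X.ter w) + if w = e then X.k (X.ini e) * η else 0 := by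
      intro w
      have hb : (X.b w : ℝ) ≠ 0 := by exact_mod_cast (X.b_pos w).ne'
      rw [div_mul_eq_mul_div, hmul]
      by_cases hw : w = e
      · subst hw; simp only [N, if_true]; field_simp
      · simp [N, hw, div_mul_eq_mul_div]
    simp only [hsum, Finset.sum_add_distrib, ← h.bkn u, Finset.sum_ite_eq', Finset.mem_filter,
      Finset.mem_univ, true_and]
    by_cases hu : u = X.ini e
    · subst hu; simp [A, mul_add]
    · simp [A, hu, Ne.symm hu]
  · intro w
    by_cases hw : w = e
    · subst hw; exact (hlt w he).le
    · rw [hGne w hw, abs_mul, abs_of_nonneg (hratio0 _)]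
      exact mul_le_one₀ (h.le_one w) (hratio0 _) (hratio _)
  · intro w hw
    simp [G, hw]
  · exact (h.nonneg _).trans_lt hAv
  · intro w hwt
    by_cases hw : w = e
    · subst hw; exact hlt w he
    · rw [hGne w hw, abs_mul, abs_of_nonneg (hratio0 _), hwt]
      refine (mul_le_of_le_one_left (hratio0 _) (h.le_one w)).trans_lt ?_
      exact (div_lt_one ((h.nonneg _).trans_lt hAv)).2 hAv

/-- A weak solution with a slack vertex can be perturbed to one with all lengths positive
and all angles of absolute value below one. -/
theorem WeakSol.exists_forall_regular {X : LabeledGraph V W} {a : V → ℝ} {γ : W → ℝ}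
    (h : X.WeakSol a γ) (hs : ∃ v, X.Slack a γ v) {ε : ℝ} (hε : 0 < ε) :
    ∃ (a' : V → ℝ) (γ' : W → ℝ), X.WeakSol a' γ' ∧ (∀ v, X.Regular a' γ' v) ∧
      (∀ u, |a' u - a u| < ε) ∧ ∀ w, |γ' w - γ w| < ε := by
  classical
  induction hn : (Finset.univ.filter fun v => ¬ X.Regular a γ v).card
    using Nat.strong_induction_on generalizing a γ ε with
  | _ n ih =>
  by_cases hall : ∀ v, X.Regular a γ v
  · exact ⟨a, γ, h, hall, by simp [hε], by simp [hε]⟩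
  obtain ⟨y, hy, hyr⟩ : ∃ y, X.Slack a γ y ∧ ¬ X.Regular a γ y := by
    obtain ⟨s, hs⟩ := hs
    by_cases hsr : X.Regular a γ s
    · push Not at hall
      obtain ⟨z, hz⟩ := hall
      obtain ⟨w, hw, hw'⟩ := X.exists_edge_leaving hsr hz
      exact ⟨X.ter w, ⟨X.rev w, rfl, hw.2 _ (X.ter_rev w), by rw [X.ter_rev]; exact hw.1⟩, hw'⟩
    · exact ⟨s, hs, hsr⟩
  obtain ⟨a₁, γ₁, h₁, hreg, hpos, hlt, ha, hγ⟩ := h.exists_regular_at hy (half_pos hε)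
  have hcard : (Finset.univ.filter fun v => ¬ X.Regular a₁ γ₁ v).card < n := by
    rw [← hn]
    refine Finset.card_lt_card (Finset.ssubset_iff_of_subset ?_ |>.2 ⟨y, ?_, ?_⟩)
    · intro v
      simp only [Finset.mem_filter, Finset.mem_univ, true_and]
      exact mt fun hv => ⟨hpos v hv.1, fun w hw => hlt w (hv.2 w hw)⟩
    · simpa using hyr
    · simpa using hreg
  obtain ⟨w, hwy, hw, hwt⟩ := hy
  obtain ⟨a₂, γ₂, h₂, hreg₂, ha₂, hγ₂⟩ :=
    ih _ hcard h₁ ⟨y, w, hwy, hlt w hw, hpos _ hwt⟩ (half_pos hε) rfl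
  refine ⟨a₂, γ₂, h₂, hreg₂, fun u => ?_, fun w => ?_⟩
  · linarith [abs_sub_le (a₂ u) (a₁ u) (a u), ha u, ha₂ u]
  · linarith [abs_sub_le (γ₂ w) (γ₁ w) (γ w), hγ w, hγ₂ w]

/-- A compatible solution with an angle of absolute value below one has a slack vertex. -/
theorem Compatible.exists_slack {X : LabeledGraph V W} {a : V → ℝ} {γ : W → ℝ}
    (h : X.Compatible a γ) (hw : ∃ w, |γ w| < 1) : ∃ v, X.Slack a γ v := by
  obtain ⟨hnn, hne, -, -, hz⟩ := h
  obtain ⟨w₀, hw₀⟩ := hw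
  by_cases h0 : a (X.ter w₀) = 0
  · obtain ⟨v, hv⟩ := Function.ne_iff.1 hne
    obtain ⟨w, hw, hw'⟩ := X.exists_edge_leaving (p := fun u => a u = 0) h0 hv
    refine ⟨_, w, rfl, ?_, (hnn _).lt_of_ne' hw'⟩
    simp [(hz _ hw w rfl).1]
  · exact ⟨_, w₀, rfl, hw₀, (hnn _).lt_of_ne' h0⟩

/-- Over rational charges, a solution with positive lengths can be approximated by rational
solutions. -/
theorem BKN.exists_rat {X : LabeledGraph V W} (hk : ∀ v, ∃ q : ℚ, X.k v = q)
    {a : V → ℝ} {γ : W → ℝ} (h : X.BKN a γ) (ha : ∀ v, 0 < a v)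
    {P : (V → ℝ) → (W → ℝ) → Prop} (hP : ∀ᶠ x in 𝓝 (a, γ), P x.1 x.2) :
    ∃ (a' : V → ℚ) (γ' : W → ℚ), X.BKN (fun v => a' v) (fun w => γ' w) ∧
      P (fun v => a' v) (fun w => γ' w) := by
  choose κ hκ using hk
  choose e he using X.exists_ini_eq
  let R : V → (V → ℝ) → (W → ℝ) → ℝ := fun v a γ =>
    ∑ w ∈ univ.filter (fun w => X.ini w = v ∧ w ≠ e v), γ w / (X.b w : ℝ) * a (X.ter w)
  have hsplit : ∀ v (a : V → ℝ) (γ : W → ℝ),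
      ∑ w ∈ univ.filter (fun w => X.ini w = v), γ w / (X.b w : ℝ) * a (X.ter w) =
        γ (e v) / (X.b (e v) : ℝ) * a (X.ter (e v)) + R v a γ := by
    intro v a γ
    rw [← Finset.add_sum_erase _ _ (show e v ∈ univ.filter (fun w => X.ini w = v) by simp [he])]
    congr 2
    ext w
    simp [and_comm]
  let F : (V → ℝ) × (W → ℝ) → W → ℝ := fun x w =>
    if w = e (X.ini w) then
      X.b w * (X.k (X.ini w) * x.1 (X.ini w) - R (X.ini w) x.1 x.2) / x.1 (X.ter w)
    else x.2 w
  have hb : ∀ w, (X.b w : ℝ) ≠ 0 := fun w => by exact_mod_cast (X.b_pos w).ne'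
  have hF : F (a, γ) = γ := by
    funext w
    by_cases hw : w = e (X.ini w)
    · have h1 := (h (X.ini w)).trans (hsplit _ a γ)
      rw [← hw] at h1
      have h2 := (ha (X.ter w)).ne'
      have := hb w
      simp only [F, if_pos hw, h1]
      field_simp
      ring
    · simp [F, hw]
  have hFc : ContinuousAt F (a, γ) := by
    refine continuousAt_pi.2 fun w => ?_
    by_cases hw : w = e (X.ini w)
    · simp only [F, if_pos hw, R]
      refine ContinuousAt.div (by fun_prop) (by fun_prop) (ha _).ne'
    · simp only [F, if_neg hw]
      fun_prop
  have hev : ∀ᶠ x in 𝓝 (a, γ), (∀ v, 0 < x.1 v) ∧ P x.1 (F x) := by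
    refine (eventually_all.2 fun v => ?_).and ?_
    · have : ContinuousAt (fun x : (V → ℝ) × (W → ℝ) => x.1 v) (a, γ) := by fun_prop
      exact this.eventually_const_lt (ha v)
    · have hc : Tendsto (fun x => (x.1, F x)) (𝓝 (a, γ)) (𝓝 (a, γ)) := by
        have := continuousAt_fst.prodMk hFc
        simpa only [ContinuousAt, hF] using this
      exact hc.eventually hP
  obtain ⟨s, hs, t, ht, hst⟩ := mem_nhds_prod_iff.1 hev
  obtain ⟨a', ha'⟩ := exists_rat_fun_mem_of_mem_nhds hs
  obtain ⟨g, hg⟩ := exists_rat_fun_mem_of_mem_nhds ht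
  obtain ⟨hpos, hP'⟩ := hst (Set.mk_mem_prod ha' hg)
  let γ' : W → ℚ := fun w =>
    if w = e (X.ini w) then
      X.b w * (κ (X.ini w) * a' (X.ini w) -
        ∑ w' ∈ univ.filter (fun w' => X.ini w' = X.ini w ∧ w' ≠ e (X.ini w)),
          g w' / (X.b w' : ℚ) * a' (X.ter w')) / a' (X.ter w)
    else g w
  have hγ' : F (fun v => (a' v : ℝ), fun w => (g w : ℝ)) = fun w => (γ' w : ℝ) := by
    funext w
    by_cases hw : w = e (X.ini w)
    · simp only [F, γ', R, if_pos hw, hκ]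
      push_cast
      rfl
    · simp [F, γ', hw]
  refine ⟨a', γ', fun v => ?_, by rwa [hγ'] at hP'⟩
  have hR : R v (fun v => (a' v : ℝ)) (fun w => (γ' w : ℝ)) =
      R v (fun v => (a' v : ℝ)) (fun w => (g w : ℝ)) := by
    refine Finset.sum_congr rfl fun w hw => ?_
    obtain ⟨-, rfl, hw⟩ := Finset.mem_filter.1 hw
    simp [γ', hw]
  have hv : (γ' (e v) : ℝ) = X.b (e v) * (X.k v * a' v -
      R v (fun v => (a' v : ℝ)) (fun w => (g w : ℝ))) / a' (X.ter (e v)) := by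
    rw [← congrFun hγ' (e v)]
    simp [F, he]
  have h1 := (hpos (X.ter (e v))).ne'
  have h2 := hb (e v)
  dsimp only at h1
  refine Eq.trans ?_ (hsplit v (fun v => (a' v : ℝ)) (fun w => (γ' w : ℝ))).symm
  rw [hR, hv]
  field_simp
  ring

end LabeledGraph

open LabeledGraph in
/-- Rational approximation of compatible solutions of the BKN-equation over a labeled
graph with rational charges: (1) if the angle function takes values in `{0, ±1}`, the
length function can be approximated by rational length functions with the same angle
function and the same zeroes; (2) if `|γ_{w₀}| < 1` for some edge `w₀`, the solution can be
approximated by rational compatible solutions with positive length function and all angles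
of absolute value `< 1`. -/
theorem rational_approximation
    {V W : Type} [Fintype V] [DecidableEq V] [Fintype W] [DecidableEq W]
    (X : LabeledGraph V W) (hk : ∀ v, ∃ q : ℚ, X.k v = q)
    (a : V → ℝ) (γ : W → ℝ)
    (hsol : X.BKN a γ) (hcomp : X.Compatible a γ) :
    ((∀ w, γ w = 0 ∨ γ w = 1 ∨ γ w = -1) →
      ∀ ε > (0 : ℝ), ∃ a' : V → ℝ,
        X.BKN a' γ ∧ X.Compatible a' γ ∧ (∀ v, ∃ q : ℚ, a' v = q) ∧
        (∀ v, |a' v - a v| < ε) ∧ ∀ v, a v = 0 → a' v = a v) ∧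
    ((∃ w₀, |γ w₀| < 1) →
      ∀ ε > (0 : ℝ), ∃ (a' : V → ℝ) (γ' : W → ℝ),
        X.BKN a' γ' ∧ X.Compatible a' γ' ∧
        (∀ v, ∃ q : ℚ, a' v = q) ∧ (∀ w, ∃ q : ℚ, γ' w = q) ∧
        (∀ v, 0 < a' v) ∧ (∀ w, |γ' w| < 1) ∧
        (∀ v, |a' v - a v| < ε) ∧ ∀ w, |γ' w - γ w| < ε) := by
  refine ⟨fun hγ ε hε => ?_, fun hw ε hε => ?_⟩
  · obtain ⟨hnn, -, hle, hsym, hz⟩ := id hcomp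
    have hU : ∀ᶠ x in 𝓝 a, (∀ v, 0 < a v → 0 < x v) ∧ ∀ v, |x v - a v| < ε := by
      refine (eventually_all.2 fun v => ?_).and (eventually_all.2 fun v => ?_)
      · by_cases hv : 0 < a v
        · filter_upwards [(continuous_apply v).continuousAt.eventually_const_lt hv] with x hx _
            using hx
        · simp [hv]
      · exact Metric.tendsto_nhds.1 ((continuous_apply v).tendsto a) ε hε
    obtain ⟨f, hpos, hclose⟩ := exists_rat_linear_mem_of_mem_nhds hU
    have hzero : ∀ v, (f (a v) : ℝ) = 0 → a v = 0 := by
      intro v hv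
      by_contra h
      exact (hpos v ((hnn v).lt_of_ne' h)).ne' hv
    have hf : ∀ (q : ℚ) (x : ℝ), f (q * x) = q * f x := by
      intro q x
      rw [← Rat.smul_def, map_smul, smul_eq_mul]
    refine ⟨fun v => f (a v), fun v => ?_, ⟨fun v => ?_, fun h => ?_, hle, hsym,
      fun v hv => hz v (hzero v hv)⟩, fun v => ⟨_, rfl⟩, hclose, fun v hv => by simp [hv]⟩
    · obtain ⟨κ, hκ⟩ := hk v
      have hg : ∀ w, ∃ q : ℚ, γ w / (X.b w : ℝ) = q := by
        intro w
        rcases hγ w with h | h | h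
        · exact ⟨0, by simp [h]⟩
        · exact ⟨1 / X.b w, by simp [h]⟩
        · exact ⟨-1 / X.b w, by simp [h]⟩
      choose g hg using hg
      have h := congrArg f (hsol v)
      simp only [hκ, hg, hf, map_sum] at h ⊢
      exact_mod_cast h
    · rcases (hnn v).eq_or_lt with h | h
      · simp [← h]
      · exact (hpos v h).le
    · exact hcomp.2.1 (funext fun v => hzero v (congrFun h v))
  · have hweak : X.WeakSol a γ := by
      refine ⟨hsol, hcomp.1, hcomp.2.2.1, fun w h => ?_⟩
      simpa [X.rev_invol] using (hcomp.2.2.2.2 _ h (X.rev w) rfl).2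
    obtain ⟨a₁, γ₁, h₁, hreg, ha, hγ⟩ :=
      hweak.exists_forall_regular (hcomp.exists_slack hw) hε
    have hP : ∀ᶠ x in 𝓝 (a₁, γ₁), ((∀ v, 0 < x.1 v) ∧ ∀ w, |x.2 w| < 1) ∧
        (∀ v, |x.1 v - a v| < ε) ∧ ∀ w, |x.2 w - γ w| < ε := by
      refine ((eventually_all.2 fun v => ?_).and (eventually_all.2 fun w => ?_)).and
        ((eventually_all.2 fun v => ?_).and (eventually_all.2 fun w => ?_))
      · exact Tendsto.eventually_const_lt (hreg v).1 (ContinuousAt.tendsto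
          (f := fun x : (V → ℝ) × (W → ℝ) => x.1 v) (x := (a₁, γ₁)) (by fun_prop))
      · exact Tendsto.eventually_lt_const ((hreg _).2 w rfl) (ContinuousAt.tendsto
          (f := fun x : (V → ℝ) × (W → ℝ) => |x.2 w|) (x := (a₁, γ₁)) (by fun_prop))
      · exact Tendsto.eventually_lt_const (ha v) (ContinuousAt.tendsto
          (f := fun x : (V → ℝ) × (W → ℝ) => |x.1 v - a v|) (x := (a₁, γ₁)) (by fun_prop))
      · exact Tendsto.eventually_lt_const (hγ w) (ContinuousAt.tendsto
          (f := fun x : (V → ℝ) × (W → ℝ) => |x.2 w - γ w|) (x := (a₁, γ₁)) (by fun_prop))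
    obtain ⟨a', γ', hbkn, ⟨hpos, hlt⟩, hca, hcγ⟩ := h₁.bkn.exists_rat hk (fun v => (hreg v).1)
      (P := fun x y => ((∀ v, 0 < x v) ∧ ∀ w, |y w| < 1) ∧
        (∀ v, |x v - a v| < ε) ∧ ∀ w, |y w - γ w| < ε) hP
    obtain ⟨w₀, -⟩ := hw
    refine ⟨_, _, hbkn, ⟨fun v => (hpos v).le, fun h => ?_, fun w => (hlt w).le,
      fun w h => ?_, fun v h => absurd h (hpos v).ne'⟩, fun v => ⟨_, rfl⟩, fun w => ⟨_, rfl⟩,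
      hpos, hlt, hca, hcγ⟩
    · exact (hpos (X.ini w₀)).ne' (congrFun h _)
    · rw [abs_mul] at h
      exact absurd h (mul_lt_one_of_nonneg_of_lt_one_left (abs_nonneg _) (hlt w) (hlt _).le).ne
end
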